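/- arXiv:hep-th/0407223 — 2 statements merged into one kernel-verified Lean document; each statement's English description precedes it below -/
import Mathlib

section
/- Let ζ be a real number with 0 < ζ < π. Then the density function ρ(λ) = 1/(2ζ cosh(πλ/ζ)) solves the Lieb integral equation: for every real λ, ρ(λ) + ∫_{−∞}^{∞} K(λ−μ) ρ(μ) dμ = (1/(2π)) p₀'(λ), where K(x) = sin(2ζ) / (2π (sinh²x + sin²ζ)) and p₀'(x) = sin ζ / (sinh²x + sin²(ζ/2)); equivalently, 1/(2ζ cosh(πλ/ζ)) + ∫_{−∞}^{∞} [sin(2ζ)/(2π(sinh²(λ−μ)+sin²ζ))] · [1/(2ζ cosh(πμ/ζ))] dμ = sin ζ / (2π(sinh²λ + sin²(ζ/2))). -/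
open Real MeasureTheory

open Filter Topology Complex in
theorem exists_differentiableOn_eq_off_finset {U : Set ℂ} (hU : IsOpen U) (S : Finset ℂ) :
    ∀ f : ℂ → ℂ, DifferentiableOn ℂ f (U \ S) →
      (∀ a ∈ S, Tendsto (fun z => (z - a) * f z) (𝓝[≠] a) (𝓝 0)) →
      (∀ a ∈ S, a ∈ U) →
      ∃ g : ℂ → ℂ, DifferentiableOn ℂ g U ∧ ∀ z ∉ S, g z = f z := by
  classical
  induction S using Finset.induction_on with
  | empty => exact fun f hf _ _ => ⟨f, by simpa using hf, fun _ _ => rfl⟩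
  | insert a S ha ih =>
    intro f hf hlim hSU
    have hV : IsOpen (U \ (S : Set ℂ)) := hU.sdiff S.finite_toSet.isClosed
    have haV : a ∈ U \ (S : Set ℂ) := ⟨hSU a (by simp), by simpa using ha⟩
    have ho : (fun z => f z - f a) =o[𝓝[≠] a] fun z => (z - a)⁻¹ := by
      rw [Asymptotics.isLittleO_iff_tendsto']
      · have h1 : Tendsto (fun z : ℂ => (z - a) * f a) (𝓝[≠] a) (𝓝 0) := by
          have : ContinuousAt (fun z : ℂ => (z - a) * f a) a := by fun_prop
          simpa using this.tendsto.mono_left nhdsWithin_le_nhds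
        have h2 := (hlim a (by simp)).sub h1
        rw [sub_zero] at h2
        refine h2.congr fun z => ?_
        rw [div_inv_eq_mul]
        ring
      · filter_upwards [self_mem_nhdsWithin] with z hz h0
        exact absurd (sub_eq_zero.1 (inv_eq_zero.1 h0)) hz
    have hd := differentiableOn_update_limUnder_of_isLittleO (hV.mem_nhds haV)
      (hf.mono (by rintro z ⟨⟨h1, h2⟩, h3⟩; exact ⟨h1, by simp_all⟩)) ho
    obtain ⟨g, hg, hgf⟩ := ih _ hd (fun b hb => by
        refine (hlim b (by simp [hb])).congr' ?_
        have hba : b ≠ a := fun h => ha (h ▸ hb)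
        filter_upwards [nhdsWithin_le_nhds (isOpen_ne.mem_nhds hba)] with z hz
        rw [Function.update_of_ne hz])
      (fun b hb => hSU b (by simp [hb]))
    refine ⟨g, hg, fun z hz => ?_⟩
    rw [Finset.mem_insert, not_or] at hz
    rw [hgf z hz.2, Function.update_of_ne hz.1]

open Filter Topology in
theorem Complex.tendsto_cosh_div_sinh_comap_re_atTop :
    Tendsto (fun z : ℂ => Complex.cosh z / Complex.sinh z) (comap Complex.re atTop) (𝓝 1) := by
  have h : Tendsto (fun z : ℂ => Complex.exp (-2 * z)) (comap Complex.re atTop) (𝓝 0) := by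
    refine Complex.tendsto_exp_comap_re_atBot.comp (tendsto_comap_iff.2 ?_)
    have : Tendsto (fun z : ℂ => -2 * z.re) (comap Complex.re atTop) atBot :=
      (tendsto_comap (f := Complex.re)).const_mul_atTop_of_neg (by norm_num)
    exact this.congr fun z => by simp
  have h2 : Tendsto (fun z : ℂ => (1 + Complex.exp (-2 * z)) / (1 - Complex.exp (-2 * z)))
      (comap Complex.re atTop) (𝓝 ((1 + 0) / (1 - 0))) :=
    (h.const_add 1).div (h.const_sub 1) (by norm_num)
  rw [add_zero, sub_zero, div_one] at h2
  refine h2.congr fun z => ?_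
  have e : Complex.exp (-2 * z) = Complex.exp (-z) * Complex.exp (-z) := by
    rw [← Complex.exp_add]; ring_nf
  have e1 : (1 : ℂ) = Complex.exp z * Complex.exp (-z) := by
    rw [← Complex.exp_add]; simp
  have e2 := Complex.exp_ne_zero (-z)
  rw [Complex.cosh, Complex.sinh, e]
  rw [e1, ← add_mul, ← sub_mul, mul_div_mul_right _ _ e2, div_div_div_cancel_right₀ two_ne_zero]

open Filter Topology in
theorem Complex.tendsto_neg_comap_re_atBot :
    Tendsto (fun z : ℂ => -z) (comap Complex.re atBot) (comap Complex.re atTop) :=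
  tendsto_comap_iff.2 ((tendsto_neg_atBot_atTop.comp tendsto_comap).congr fun z => by simp)

open Filter Topology in
theorem Complex.tendsto_cosh_div_sinh_comap_re_atBot :
    Tendsto (fun z : ℂ => Complex.cosh z / Complex.sinh z) (comap Complex.re atBot) (𝓝 (-1)) :=
  (Complex.tendsto_cosh_div_sinh_comap_re_atTop.comp Complex.tendsto_neg_comap_re_atBot).neg.congr
    fun z => by simp [div_neg]

open Filter Topology in
theorem Complex.tendsto_inv_cosh_comap_re_atTop :
    Tendsto (fun z : ℂ => (Complex.cosh z)⁻¹) (comap Complex.re atTop) (𝓝 0) := by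
  have h : Tendsto (fun z : ℂ => Complex.exp (-z)) (comap Complex.re atTop) (𝓝 0) := by
    refine Complex.tendsto_exp_comap_re_atBot.comp (tendsto_comap_iff.2 ?_)
    exact (tendsto_neg_atTop_atBot.comp (tendsto_comap (f := Complex.re))).congr fun z => by simp
  have h2 : Tendsto (fun z : ℂ => 2 * Complex.exp (-z) / (1 + Complex.exp (-z) * Complex.exp (-z)))
      (comap Complex.re atTop) (𝓝 (2 * 0 / (1 + 0 * 0))) :=
    (h.const_mul 2).div ((h.mul h).const_add 1) (by norm_num)
  rw [mul_zero, zero_div] at h2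
  refine h2.congr fun z => ?_
  have e1 : (1 : ℂ) = Complex.exp z * Complex.exp (-z) := by
    rw [← Complex.exp_add]; simp
  have e2 := Complex.exp_ne_zero (-z)
  rw [Complex.cosh]
  nth_rewrite 1 [e1]
  rw [← add_mul, mul_div_mul_right _ _ e2, inv_div]

open Filter Topology in
theorem Complex.tendsto_inv_cosh_comap_re_atBot :
    Tendsto (fun z : ℂ => (Complex.cosh z)⁻¹) (comap Complex.re atBot) (𝓝 0) :=
  (Complex.tendsto_inv_cosh_comap_re_atTop.comp Complex.tendsto_neg_comap_re_atBot).congr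
    fun z => by simp

open Filter Topology in
theorem Complex.tendsto_affine_comap_re {l : Filter ℝ} {c : ℝ} (a : ℂ)
    (h : Tendsto (fun x : ℝ => c * (x - a.re)) l l) :
    Tendsto (fun z : ℂ => c * (z - a)) (comap Complex.re l) (comap Complex.re l) :=
  tendsto_comap_iff.2 ((h.comp (tendsto_comap (f := Complex.re))).congr fun z => by simp)

open Filter Topology in
theorem tendsto_sub_mul_div_of_hasDerivAt {n s : ℂ → ℂ} {a s' : ℂ} (hn : ContinuousAt n a)
    (hs : HasDerivAt s s' a) (hs0 : s a = 0) (hs' : s' ≠ 0) :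
    Tendsto (fun z => (z - a) * (n z / s z)) (𝓝[≠] a) (𝓝 (n a / s')) := by
  have h1 := (hasDerivAt_iff_tendsto_slope.1 hs).inv₀ hs'
  refine ((hn.tendsto.mono_left nhdsWithin_le_nhds).mul h1).congr fun z => ?_
  rw [slope_def_field, hs0, sub_zero, inv_div]
  ring

theorem Complex.sinh_ne_zero_of_abs_im_lt_pi {w : ℂ} (hw : |w.im| < π) (hw0 : w ≠ 0) :
    Complex.sinh w ≠ 0 := by
  intro h
  have h1 : Complex.sin (w * Complex.I) = 0 := by rw [Complex.sin_mul_I, h, zero_mul]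
  obtain ⟨k, hk⟩ := Complex.sin_eq_zero_iff.1 h1
  have hre := congrArg Complex.re hk
  have him := congrArg Complex.im hk
  simp at hre him
  have hk1 : |(k : ℝ)| < 1 := by
    rw [← abs_neg, hre, abs_mul, abs_of_pos Real.pi_pos] at hw
    nlinarith [Real.pi_pos]
  have hk0 : k = 0 := by
    rw [← Int.cast_abs] at hk1
    exact Int.abs_lt_one_iff.1 (by exact_mod_cast hk1)
  subst hk0
  exact hw0 (Complex.ext (by simpa using him) (by simpa using hre))

theorem Complex.cosh_ne_zero_of_abs_im_lt {w : ℂ} (hw : |w.im| < 3 * π / 2)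
    (hw1 : w ≠ π / 2 * Complex.I) (hw2 : w ≠ -(π / 2 * Complex.I)) :
    Complex.cosh w ≠ 0 := by
  intro h
  rw [← Complex.cos_mul_I] at h
  obtain ⟨k, hk⟩ := Complex.cos_eq_zero_iff.1 h
  have hw' : w = -((2 * k + 1) * π / 2 * Complex.I) := by
    rw [← hk, mul_assoc, Complex.I_mul_I]; ring
  have him : w.im = -((2 * k + 1) * π / 2) := by
    rw [hw']; simp
  rw [him, abs_lt] at hw
  have h1 : (k : ℝ) < 1 := by nlinarith [Real.pi_pos]
  have h2 : (-2 : ℝ) < k := by nlinarith [Real.pi_pos]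
  have h1' : k < 1 := by exact_mod_cast h1
  have h2' : -2 < k := by exact_mod_cast h2
  obtain rfl | rfl : k = 0 ∨ k = -1 := by omega
  · exact hw2 (by rw [hw']; push_cast; ring)
  · exact hw1 (by rw [hw']; push_cast; ring)

open Filter Topology in
theorem tendsto_intervalIntegral_vertical {ι : Type*} {m : Filter ι} [m.IsCountablyGenerated]
    {l : Filter ℝ} {g : ℂ → ℂ} {L : ℂ}
    (hg : Tendsto g (comap Complex.re l) (𝓝 L)) {x : ι → ℝ} (hx : Tendsto x m l) (a b : ℝ)
    (hc : ∀ t : ℝ, ContinuousOn (fun y : ℝ => g (t + y * Complex.I)) (Set.uIcc a b)) :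
    Tendsto (fun i => ∫ y in a..b, g (x i + y * Complex.I)) m (𝓝 ((b - a : ℝ) * L)) := by
  have hev : ∀ s ∈ 𝓝 L, ∀ᶠ i in m, ∀ y : ℝ, g (x i + y * Complex.I) ∈ s := by
    intro s hs
    obtain ⟨t, ht, hts⟩ := mem_comap.1 (hg hs)
    filter_upwards [hx ht] with i hi y
    exact hts (show (x i + y * Complex.I : ℂ).re ∈ t by simpa using hi)
  have := intervalIntegral.tendsto_integral_filter_of_dominated_convergence (μ := volume)
    (a := a) (b := b) (l := m) (F := fun i y => g (x i + y * Complex.I)) (f := fun _ => L)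
    (fun _ => ‖L‖ + 1)
    (Eventually.of_forall fun i =>
      ((hc (x i)).mono Set.uIoc_subset_uIcc).aestronglyMeasurable measurableSet_uIoc)
    ((hev _ (Metric.ball_mem_nhds L one_pos)).mono fun i hi =>
      Eventually.of_forall fun y _ => by
        have h1 := hi y
        rw [mem_ball_iff_norm] at h1
        have h2 := norm_le_norm_add_norm_sub' (g (x i + y * Complex.I)) L
        linarith)
    (by simp)
    (Eventually.of_forall fun y _ => fun s hs => (hev s hs).mono fun i hi => hi y)
  simpa using this

open Filter Topology in
/-- A residue theorem for the strip `|Im z| ≤ ζ`. -/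
theorem tendsto_integral_strip_of_simple_poles {ζ η : ℝ} (hζ : 0 < ζ) (hη : ζ < η) (S : Finset ℂ)
    (hS : ∀ a ∈ S, |a.im| < ζ) (hS' : ∀ a ∈ S, |a.im| + η ≤ 2 * ζ) {F : ℂ → ℂ} (r : ℂ → ℂ)
    (hF : DifferentiableOn ℂ F ({z | |z.im| < η} \ S))
    (hr : ∀ a ∈ S, Tendsto (fun z => (z - a) * F z) (𝓝[≠] a) (𝓝 (r a)))
    (htop : Tendsto F (comap Complex.re atTop) (𝓝 0))
    (hbot : Tendsto F (comap Complex.re atBot) (𝓝 0)) :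
    Tendsto (fun R : ℝ => ∫ x in -R..R, (F (x - ζ * Complex.I) - F (x + ζ * Complex.I))) atTop
      (𝓝 (2 * π * Complex.I * ∑ a ∈ S, r a)) := by
  classical
  set c : ℝ := π / (2 * ζ) with hc
  have hcpos : 0 < c := by positivity
  have hcζ : (c : ℂ) * ζ * 2 = π := by
    have : c * ζ * 2 = π := by rw [hc]; field_simp
    exact_mod_cast this
  set f : ℂ → ℂ → ℂ := fun a z =>
    c * Complex.cosh (c * (z - a)) / Complex.sinh (c * (z - a)) with hf
  set U : Set ℂ := {z | |z.im| < η} with hUdef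
  have hU : IsOpen U := isOpen_lt (by fun_prop) (by fun_prop)
  have hSU : ∀ a ∈ S, a ∈ U := fun a ha => (hS a ha).trans hη
  have hsinh : ∀ a ∈ S, ∀ z ∈ U, z ≠ a → Complex.sinh (c * (z - a)) ≠ 0 := by
    intro a ha z hz hza
    refine Complex.sinh_ne_zero_of_abs_im_lt_pi ?_
      (mul_ne_zero (by exact_mod_cast hcpos.ne') (sub_ne_zero.2 hza))
    have h1 : |z.im - a.im| < 2 * ζ := by
      have := abs_sub z.im a.im
      have h2 : |z.im| < η := hz
      have := hS' a ha
      linarith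
    have h3 : (c * (z - a) : ℂ).im = c * (z.im - a.im) := by simp
    rw [h3, abs_mul, abs_of_pos hcpos]
    calc c * |z.im - a.im| < c * (2 * ζ) := by gcongr
      _ = π := by rw [hc]; field_simp
  have hfd : ∀ a ∈ S, ∀ z ∈ U, z ≠ a → DifferentiableAt ℂ (f a) z := by
    intro a ha z hz hza
    exact DifferentiableAt.fun_div (by fun_prop) (by fun_prop) (hsinh a ha z hz hza)
  have hfr : ∀ a, Tendsto (fun z => (z - a) * f a z) (𝓝[≠] a) (𝓝 1) := by
    intro a
    have h := tendsto_sub_mul_div_of_hasDerivAt (a := a) (s' := c)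
      (n := fun z : ℂ => c * Complex.cosh (c * (z - a)))
      (s := fun z : ℂ => Complex.sinh (c * (z - a))) (by fun_prop)
      (by
        have h := (((hasDerivAt_id a).sub_const a).const_mul (c : ℂ)).csinh
        simpa using h) (by simp) (by exact_mod_cast hcpos.ne')
    have hc0 : (c : ℂ) ≠ 0 := by exact_mod_cast hcpos.ne'
    simpa [hc0] using h
  have hftop : ∀ a, Tendsto (f a) (comap Complex.re atTop) (𝓝 c) := by
    intro a
    have h := (Complex.tendsto_cosh_div_sinh_comap_re_atTop.comp
      (Complex.tendsto_affine_comap_re (c := c) a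
        ((tendsto_atTop_add_const_right _ (-a.re) tendsto_id).const_mul_atTop hcpos))).const_mul
          (c : ℂ)
    rw [mul_one] at h
    exact h.congr fun z => by simp [hf, mul_div_assoc]
  have hfbot : ∀ a, Tendsto (f a) (comap Complex.re atBot) (𝓝 (-c)) := by
    intro a
    have h := (Complex.tendsto_cosh_div_sinh_comap_re_atBot.comp
      (Complex.tendsto_affine_comap_re (c := c) a
        ((tendsto_atBot_add_const_right _ (-a.re) tendsto_id).const_mul_atBot hcpos))).const_mul
          (c : ℂ)
    rw [mul_neg_one] at h
    exact h.congr fun z => by simp [hf, mul_div_assoc]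
  have hfper : ∀ a z, f a (z + ζ * Complex.I) = f a (z - ζ * Complex.I) := by
    intro a z
    have h : (c : ℂ) * (z + ζ * Complex.I - a) = c * (z - ζ * Complex.I - a) + π * Complex.I := by
      rw [← hcζ]; ring
    simp only [hf]
    rw [h, Complex.sinh_add_pi_mul_I, Complex.cosh_add_pi_mul_I]
    rw [mul_neg, neg_div_neg_eq]
  obtain ⟨g, hg, hgF⟩ := exists_differentiableOn_eq_off_finset hU S
    (fun z => F z - ∑ a ∈ S, r a * f a z) (by
      refine hF.sub (DifferentiableOn.fun_sum fun a ha z hz => ?_)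
      exact ((hfd a ha z hz.1 fun h => hz.2 (h ▸ ha)).const_mul _).differentiableWithinAt)
    (by
      intro a ha
      have h1 : Tendsto (fun z => (z - a) * (r a * f a z)) (𝓝[≠] a) (𝓝 (r a)) := by
        have := (hfr a).const_mul (r a)
        rw [mul_one] at this
        exact this.congr fun z => by ring
      have h2 : Tendsto (fun z => (z - a) * ∑ b ∈ S.erase a, r b * f b z) (𝓝[≠] a) (𝓝 0) := by
        have : ContinuousAt (fun z => (z - a) * ∑ b ∈ S.erase a, r b * f b z) a := by
          refine ContinuousAt.mul (by fun_prop) (tendsto_finsetSum _ fun b hb => ?_)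
          rw [Finset.mem_erase] at hb
          exact ((hfd b hb.2 a (hSU a ha) hb.1.symm).const_mul _).continuousAt
        simpa using this.tendsto.mono_left nhdsWithin_le_nhds
      have h3 := ((hr a ha).sub h1).sub h2
      rw [sub_self, sub_zero] at h3
      refine h3.congr fun z => ?_
      rw [← Finset.add_sum_erase S _ ha]
      ring) hSU
  have hne : ∀ l : Filter ℝ, Tendsto (fun x : ℝ => |x|) l atTop →
      ∀ᶠ z in comap Complex.re l, z ∉ S := by
    intro l hl
    suffices ∀ᶠ z in comap Complex.re l, ∀ a ∈ S, z ≠ a from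
      this.mono fun z hz hzS => hz z hzS rfl
    rw [Filter.eventually_all_finset]
    intro a _
    filter_upwards [(hl.comp (tendsto_comap (f := Complex.re))).eventually_gt_atTop |a.re|]
      with z hz h
    simp [h] at hz
  have hgtop : Tendsto g (comap Complex.re atTop) (𝓝 (-∑ a ∈ S, r a * c)) := by
    have h := htop.sub (tendsto_finsetSum S fun a _ => (hftop a).const_mul (r a))
    rw [zero_sub] at h
    refine h.congr' ?_
    filter_upwards [hne atTop tendsto_abs_atTop_atTop] with z hz
    rw [hgF z hz]
  have hgbot : Tendsto g (comap Complex.re atBot) (𝓝 (∑ a ∈ S, r a * c)) := by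
    have h := hbot.sub (tendsto_finsetSum S fun a _ => (hfbot a).const_mul (r a))
    have e : (0 - ∑ a ∈ S, r a * -(c : ℂ)) = ∑ a ∈ S, r a * c := by simp
    rw [e] at h
    refine h.congr' ?_
    filter_upwards [hne atBot tendsto_abs_atBot_atTop] with z hz
    rw [hgF z hz]
  have hgc : ContinuousOn g U := hg.continuousOn
  have hvert : ∀ t : ℝ, ContinuousOn (fun y : ℝ => g (t + y * Complex.I)) (Set.uIcc (-ζ) ζ) := by
    intro t
    refine hgc.comp (by fun_prop) fun y hy => ?_
    rw [Set.uIcc_of_le (by linarith)] at hy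
    have : |y| < η := (abs_le.2 hy).trans_lt hη
    simpa [hUdef] using this
  have hR := tendsto_intervalIntegral_vertical hgtop tendsto_id (-ζ) ζ hvert
  have hL := tendsto_intervalIntegral_vertical hgbot tendsto_neg_atTop_atBot (-ζ) ζ hvert
  have key := (hL.const_mul Complex.I).sub (hR.const_mul Complex.I)
  have elim : Complex.I * (((ζ - -ζ : ℝ) : ℂ) * ∑ a ∈ S, r a * c) -
      Complex.I * (((ζ - -ζ : ℝ) : ℂ) * -∑ a ∈ S, r a * c) =
      2 * π * Complex.I * ∑ a ∈ S, r a := by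
    rw [← Finset.sum_mul, ← hcζ]; push_cast; ring
  rw [elim] at key
  refine key.congr fun R => ?_
  have hη0 : ∀ s : ℝ, |s| = ζ → Continuous fun x : ℝ => g (x + s * Complex.I) := by
    intro s hs
    refine hgc.comp_continuous (by fun_prop) fun x => ?_
    simpa [hUdef, hs] using hη
  have hgline : ∀ s : ℝ, |s| = ζ → ∀ x : ℝ, g (x + s * Complex.I) =
      F (x + s * Complex.I) - ∑ a ∈ S, r a * f a (x + s * Complex.I) := by
    intro s hs x
    refine hgF _ fun h => ?_
    have := hS _ h
    simp [hs] at this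
  have rect := Complex.integral_boundary_rect_eq_zero_of_differentiableOn g
    (-R + (-ζ : ℝ) * Complex.I) (R + ζ * Complex.I) (hg.mono (by
      intro z hz
      have := hz.2
      simp only [Set.mem_preimage] at this
      simp at this
      rw [Set.uIcc_of_le (by linarith)] at this
      exact (abs_le.2 this).trans_lt hη))
  simp only [Complex.add_re, Complex.add_im, Complex.neg_re, Complex.neg_im, Complex.ofReal_re,
    Complex.ofReal_im, Complex.mul_re, Complex.mul_im, Complex.I_re, Complex.I_im, mul_zero,
    mul_one, sub_zero, add_zero, zero_add, neg_zero, smul_eq_mul] at rect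
  rw [← intervalIntegral.integral_sub ((hη0 (-ζ) (by simp [abs_of_pos hζ])).intervalIntegrable _ _)
    ((hη0 ζ (abs_of_pos hζ)).intervalIntegrable _ _)] at rect
  have hcongr : ∀ x : ℝ, g (x + (-ζ : ℝ) * Complex.I) - g (x + ζ * Complex.I) =
      F (x - ζ * Complex.I) - F (x + ζ * Complex.I) := by
    intro x
    rw [hgline _ (by simp [abs_of_pos hζ]), hgline _ (abs_of_pos hζ)]
    simp only [hfper]
    rw [Complex.ofReal_neg, neg_mul, ← sub_eq_add_neg]
    ring
  simp only [hcongr] at rect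
  simp only [id]
  linear_combination -rect

theorem Real.integrable_inv_cosh : Integrable fun x : ℝ => (Real.cosh x)⁻¹ := by
  refine (integrable_inv_one_add_sq.const_mul 4).mono'
    (Real.continuous_cosh.inv₀ fun x => (Real.cosh_pos x).ne').aestronglyMeasurable
    (Filter.Eventually.of_forall fun x => ?_)
  rw [Real.norm_of_nonneg (inv_nonneg.2 (Real.cosh_pos x).le), ← div_eq_mul_inv,
    inv_le_comm₀ (Real.cosh_pos x) (by positivity), inv_div, div_le_iff₀ (by norm_num)]
  have h1 := Real.quadratic_le_exp_of_nonneg (abs_nonneg x)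
  have h2 := Real.exp_pos (-|x|)
  have h3 := Real.cosh_eq |x|
  rw [Real.cosh_abs] at h3
  have h4 := abs_nonneg x
  rw [sq_abs] at h1
  linarith

theorem Complex.sinh_sub_mul_sinh_add_mul_I (x y : ℂ) :
    Complex.sinh (x - y * Complex.I) * Complex.sinh (x + y * Complex.I) =
      Complex.sinh x ^ 2 + Complex.sin y ^ 2 := by
  rw [Complex.sinh_sub, Complex.sinh_add, Complex.sinh_mul_I, Complex.cosh_mul_I]
  linear_combination Complex.sinh x ^ 2 * Complex.sin_sq_add_cos_sq y -
    Complex.cosh x ^ 2 * Complex.sin y ^ 2 * Complex.I_sq +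
    Complex.sin y ^ 2 * Complex.cosh_sq x

/-- The difference of two shifted hyperbolic cotangents as a Lorentzian-type kernel. -/
theorem Complex.coth_sub_coth_mul_I (x y : ℝ) (hy : Real.sin y ≠ 0) :
    Complex.cosh (x - y * Complex.I) / Complex.sinh (x - y * Complex.I) -
      Complex.cosh (x + y * Complex.I) / Complex.sinh (x + y * Complex.I) =
    Complex.I * (Real.sin (2 * y) / (Real.sinh x ^ 2 + Real.sin y ^ 2) : ℝ) := by
  have hprod := Complex.sinh_sub_mul_sinh_add_mul_I x y
  have hpos : (Complex.sinh x ^ 2 + Complex.sin y ^ 2 : ℂ) ≠ 0 := by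
    have : Real.sinh x ^ 2 + Real.sin y ^ 2 ≠ 0 := by positivity
    exact_mod_cast this
  have hne := hprod ▸ hpos
  rw [div_sub_div _ _ (left_ne_zero_of_mul hne) (right_ne_zero_of_mul hne), hprod]
  have hnum : Complex.cosh (x - y * Complex.I) * Complex.sinh (x + y * Complex.I) -
      Complex.sinh (x - y * Complex.I) * Complex.cosh (x + y * Complex.I) =
      Complex.I * Complex.sin (2 * y) := by
    have h : (2 * y * Complex.I : ℂ) = (x + y * Complex.I) - (x - y * Complex.I) := by ring
    rw [mul_comm Complex.I, ← Complex.sinh_mul_I, h,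
      Complex.sinh_sub (x + y * Complex.I)]
    ring
  rw [hnum]
  push_cast
  ring

/-- The density `ρ(λ) = 1/(2ζ cosh(πλ/ζ))` solves the Lieb integral equation
`ρ(λ) + ∫ K(λ−μ) ρ(μ) dμ = p₀'(λ)/(2π)` with kernel
`K(x) = sin(2ζ)/(2π(sinh²x + sin²ζ))` and
`p₀'(x) = sin ζ/(sinh²x + sin²(ζ/2))`, for `0 < ζ < π`. -/
theorem density_solves_lieb_equation (ζ : ℝ) (hζ0 : 0 < ζ) (hζπ : ζ < Real.pi)
    (lam : ℝ) :
    1 / (2 * ζ * Real.cosh (Real.pi * lam / ζ)) +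
      ∫ μ : ℝ,
        (Real.sin (2 * ζ) /
            (2 * Real.pi * (Real.sinh (lam - μ) ^ 2 + Real.sin ζ ^ 2))) *
          (1 / (2 * ζ * Real.cosh (Real.pi * μ / ζ))) =
    Real.sin ζ / (2 * Real.pi * (Real.sinh lam ^ 2 + Real.sin (ζ / 2) ^ 2)) := by
  have hsin : 0 < Real.sin ζ := Real.sin_pos_of_pos_of_lt_pi hζ0 hζπ
  have hsin2 : 0 < Real.sin (ζ / 2) :=
    Real.sin_pos_of_pos_of_lt_pi (by linarith) (by linarith)
  have hζc : (ζ : ℂ) ≠ 0 := by exact_mod_cast hζ0.ne'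
  have hπc : (π : ℂ) ≠ 0 := by exact_mod_cast Real.pi_ne_zero
  set G : ℝ → ℝ := fun μ => (Real.sin (2 * ζ) /
            (2 * Real.pi * (Real.sinh (lam - μ) ^ 2 + Real.sin ζ ^ 2))) *
          (1 / (2 * ζ * Real.cosh (Real.pi * μ / ζ))) with hG
  have hGint : Integrable G := by
    refine Integrable.bdd_mul (c := |Real.sin (2 * ζ)| / (2 * π * Real.sin ζ ^ 2)) ?_ ?_ ?_
    · have := (Real.integrable_inv_cosh.comp_mul_left'
        (div_ne_zero Real.pi_ne_zero hζ0.ne')).const_mul (1 / (2 * ζ))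
      refine this.congr (Filter.Eventually.of_forall fun x => ?_)
      simp only
      rw [← div_mul_eq_mul_div π ζ x, one_div, one_div, mul_inv (2 * ζ)]
    · refine Continuous.aestronglyMeasurable ?_
      refine Continuous.div (by fun_prop) (by fun_prop) fun x => ?_
      positivity
    · refine Filter.Eventually.of_forall fun x => ?_
      rw [norm_div, Real.norm_eq_abs, Real.norm_of_nonneg (by positivity)]
      gcongr
      nlinarith [sq_nonneg (Real.sinh (lam - x))]
  set F : ℂ → ℂ := fun z => Complex.cosh (lam - z) / Complex.sinh (lam - z) *
    (1 / (2 * ζ * Complex.cosh (π * z / ζ))) with hF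
  have hFG : ∀ x : ℝ, F (x - ζ * Complex.I) - F (x + ζ * Complex.I) =
      (2 * π * Complex.I) * (G x : ℂ) := by
    intro x
    have e1 : (π * (x - ζ * Complex.I) / ζ : ℂ) = π * x / ζ - π * Complex.I := by field_simp
    have e2 : (π * (x + ζ * Complex.I) / ζ : ℂ) = π * x / ζ + π * Complex.I := by field_simp
    have e3 : (lam - (x - ζ * Complex.I) : ℂ) = (lam - x : ℝ) + ζ * Complex.I := by
      push_cast; ring
    have e4 : (lam - (x + ζ * Complex.I) : ℂ) = (lam - x : ℝ) - ζ * Complex.I := by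
      push_cast; ring
    have hk := Complex.coth_sub_coth_mul_I (lam - x) ζ hsin.ne'
    have e5 : ∀ w : ℂ, Complex.cosh (w - π * Complex.I) = -Complex.cosh w := fun w => by
      rw [← neg_eq_iff_eq_neg, ← Complex.cosh_add_pi_mul_I, sub_add_cancel]
    simp only [hF, hG]
    rw [e1, e2, e3, e4, e5, Complex.cosh_add_pi_mul_I]
    rw [mul_neg, div_neg, mul_neg, mul_neg, sub_neg_eq_add, neg_add_eq_sub, ← sub_mul, hk]
    have e6 : Real.sin (2 * ζ) / (2 * π * (Real.sinh (lam - x) ^ 2 + Real.sin ζ ^ 2)) =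
        1 / (2 * π) * (Real.sin (2 * ζ) / (Real.sinh (lam - x) ^ 2 + Real.sin ζ ^ 2)) := by
      rw [div_mul_div_comm, one_mul]
    rw [e6, Complex.ofReal_mul, Complex.ofReal_mul]
    generalize Real.sin (2 * ζ) / (Real.sinh (lam - x) ^ 2 + Real.sin ζ ^ 2) = q
    push_cast
    field_simp
  set p : ℂ := ζ / 2 * Complex.I with hp
  have hpim : p.im = ζ / 2 := by simp [hp]
  have hpabs : |ζ / 2| = ζ / 2 := abs_of_pos (by linarith)
  have hpi : (π * p / ζ : ℂ) = π / 2 * Complex.I := by rw [hp]; field_simp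
  have hni : (π * -p / ζ : ℂ) = -(π / 2 * Complex.I) := by rw [hp]; field_simp
  have hp0 : p ≠ -p := fun h => by
    have := congrArg Complex.im h
    rw [Complex.neg_im, hpim] at this
    linarith
  have hlp : (lam : ℂ) ≠ p := fun h => by
    have := congrArg Complex.im h
    rw [Complex.ofReal_im, hpim] at this
    linarith
  have hln : (lam : ℂ) ≠ -p := fun h => by
    have := congrArg Complex.im h
    rw [Complex.ofReal_im, Complex.neg_im, hpim] at this
    linarith
  have hsh : ∀ z : ℂ, |z.im| < π → z ≠ lam → Complex.sinh (lam - z) ≠ 0 := fun z hz hne =>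
    Complex.sinh_ne_zero_of_abs_im_lt_pi (by simpa using hz) (sub_ne_zero.2 hne.symm)
  have hch : ∀ z : ℂ, |z.im| < 3 * ζ / 2 → z ≠ p → z ≠ -p → Complex.cosh (π * z / ζ) ≠ 0 := by
    intro z hz h1 h2
    have hinj : ∀ w : ℂ, (π * z / ζ : ℂ) = π * w / ζ → z = w := fun w h => by
      field_simp at h
      exact h
    refine Complex.cosh_ne_zero_of_abs_im_lt ?_ ?_ ?_
    · have : (π * z / ζ : ℂ).im = π / ζ * z.im := by
        rw [mul_div_right_comm, ← Complex.ofReal_div, Complex.im_ofReal_mul]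
      rw [this, abs_mul, abs_of_pos (by positivity)]
      calc π / ζ * |z.im| < π / ζ * (3 * ζ / 2) := by gcongr
        _ = 3 * π / 2 := by field_simp
    · rw [← hpi]; exact fun h => h1 (hinj _ h)
    · rw [← hni]; exact fun h => h2 (hinj _ h)
  have hder : ∀ z : ℂ, HasDerivAt (fun z : ℂ => 2 * ζ * Complex.cosh (π * z / ζ))
      (2 * π * Complex.sinh (π * z / ζ)) z := by
    intro z
    have := ((((hasDerivAt_id z).const_mul (π : ℂ)).div_const (ζ : ℂ)).ccosh).const_mul (2 * ζ : ℂ)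
    exact this.congr_deriv (by simp only [id]; field_simp)
  have hshp : Complex.sinh (π / 2 * Complex.I) = Complex.I := by
    rw [Complex.sinh_mul_I, Complex.sin_pi_div_two, one_mul]
  have hchp : Complex.cosh (π / 2 * Complex.I) = 0 := by
    rw [Complex.cosh_mul_I, Complex.cos_pi_div_two]
  obtain ⟨η, hη1, hη2⟩ := exists_between (show ζ < min π (3 * ζ / 2) from
    lt_min hζπ (by linarith))
  have hηπ := hη2.trans_le (min_le_left _ _)
  have hηζ := hη2.trans_le (min_le_right _ _)
  set r : ℂ → ℂ := fun a =>
    if a = lam then -(1 / (2 * ζ * Complex.cosh (π * lam / ζ)))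
    else if a = p then Complex.cosh (lam - p) / Complex.sinh (lam - p) / (2 * π * Complex.I)
    else -(Complex.cosh (lam + p) / Complex.sinh (lam + p) / (2 * π * Complex.I)) with hrdef
  have hFeq : ∀ z : ℂ, Complex.cosh ((1 : ℝ) * (z - lam)) / Complex.sinh ((1 : ℝ) * (z - lam)) *
      (Complex.cosh ((π / ζ : ℝ) * (z - 0)))⁻¹ * -(1 / (2 * ζ)) = F z := by
    intro z
    have e : (lam - z : ℂ) = -(z - lam) := by ring
    simp only [hF]
    rw [e, Complex.cosh_neg, Complex.sinh_neg, Complex.ofReal_one, one_mul, sub_zero,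
      Complex.ofReal_div, div_mul_eq_mul_div, one_div, one_div, mul_inv (2 * ζ : ℂ), div_neg]
    ring_nf
  have hlim := tendsto_integral_strip_of_simple_poles hζ0 hη1 {(lam : ℂ), p, -p}
    (by simp [hpim, hζ0, hpabs])
    (by simp [hpim, hpabs]; constructor <;> linarith) (F := F) r
    (by
      rintro z ⟨hz, hzS⟩
      simp at hz hzS
      obtain ⟨h1, h2, h3⟩ := hzS
      refine DifferentiableAt.differentiableWithinAt ?_
      refine DifferentiableAt.mul ?_ ?_
      · exact DifferentiableAt.fun_div (by fun_prop) (by fun_prop) (hsh z (hz.trans hηπ) h1)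
      · exact DifferentiableAt.fun_div (by fun_prop) (by fun_prop)
          (mul_ne_zero (by simp [hζc]) (hch z (hz.trans hηζ) h2 h3)))
    (by
      have hcothc : ∀ a : ℂ, |a.im| < π → a ≠ lam →
          ContinuousAt (fun z : ℂ => Complex.cosh (lam - z) / Complex.sinh (lam - z)) a :=
        fun a h1 h2 => ContinuousAt.div (by fun_prop) (by fun_prop) (hsh a h1 h2)
      intro a ha
      simp only [Finset.mem_insert, Finset.mem_singleton] at ha
      obtain rfl | rfl | rfl := ha
      · have hne : (2 * ζ * Complex.cosh (π * lam / ζ) : ℂ) ≠ 0 :=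
          mul_ne_zero (by simp [hζc]) (hch lam (by simpa using hζ0) hlp hln)
        have h := tendsto_sub_mul_div_of_hasDerivAt (a := (lam : ℂ)) (s' := -1)
          (n := fun z : ℂ => Complex.cosh (lam - z) * (1 / (2 * ζ * Complex.cosh (π * z / ζ))))
          (s := fun z : ℂ => Complex.sinh (lam - z))
          (ContinuousAt.mul (by fun_prop) (ContinuousAt.div (by fun_prop) (by fun_prop) hne))
          (by simpa using ((hasDerivAt_id (lam : ℂ)).const_sub (lam : ℂ)).csinh)
          (by simp) (by simp)
        have hr : r lam = Complex.cosh (lam - lam) *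
            (1 / (2 * ζ * Complex.cosh (π * lam / ζ))) / -1 := by
          simp [hrdef, div_neg]
        rw [hr]
        exact h.congr fun z => by simp only [hF]; ring
      · have h := tendsto_sub_mul_div_of_hasDerivAt
          (hcothc p (by rw [hpim, abs_of_pos (by linarith)]; linarith) hlp.symm) (hder p)
          (by rw [hpi, hchp, mul_zero]) (by rw [hpi, hshp]; simp [hπc])
        have hr : r p = Complex.cosh (lam - p) / Complex.sinh (lam - p) /
            (2 * π * Complex.sinh (π * p / ζ)) := by
          rw [hpi, hshp]; simp only [hrdef, if_neg hlp.symm, if_true]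
        rw [hr]
        exact h.congr fun z => by simp only [hF]; ring
      · have h := tendsto_sub_mul_div_of_hasDerivAt
          (hcothc (-p) (by rw [Complex.neg_im, abs_neg, hpim, abs_of_pos (by linarith)]; linarith)
            hln.symm) (hder (-p))
          (by rw [hni, Complex.cosh_neg, hchp, mul_zero])
          (by rw [hni, Complex.sinh_neg, hshp]; simp [hπc])
        have hr : r (-p) = Complex.cosh (lam - -p) / Complex.sinh (lam - -p) /
            (2 * π * Complex.sinh (π * -p / ζ)) := by
          rw [hni, Complex.sinh_neg, hshp, sub_neg_eq_add, mul_neg, div_neg]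
          simp only [hrdef, if_neg hln.symm, if_neg hp0.symm]
        rw [hr]
        exact h.congr fun z => by simp only [hF]; ring)
    (by
      have h1 := Complex.tendsto_cosh_div_sinh_comap_re_atTop.comp
        (Complex.tendsto_affine_comap_re (c := 1) (lam : ℂ)
          ((Filter.tendsto_atTop_add_const_right _ (-lam) Filter.tendsto_id).const_mul_atTop one_pos))
      have h2 := Complex.tendsto_inv_cosh_comap_re_atTop.comp
        (Complex.tendsto_affine_comap_re (c := π / ζ) 0
          ((Filter.tendsto_atTop_add_const_right _ (-0) Filter.tendsto_id).const_mul_atTop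
            (show 0 < π / ζ by positivity)))
      have h := (h1.mul h2).mul_const (-(1 / (2 * ζ)) : ℂ)
      rw [mul_zero, zero_mul] at h
      exact h.congr hFeq)
    (by
      have h1 := Complex.tendsto_cosh_div_sinh_comap_re_atBot.comp
        (Complex.tendsto_affine_comap_re (c := 1) (lam : ℂ)
          ((Filter.tendsto_atBot_add_const_right _ (-lam) Filter.tendsto_id).const_mul_atBot one_pos))
      have h2 := Complex.tendsto_inv_cosh_comap_re_atBot.comp
        (Complex.tendsto_affine_comap_re (c := π / ζ) 0
          ((Filter.tendsto_atBot_add_const_right _ (-0) Filter.tendsto_id).const_mul_atBot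
            (show 0 < π / ζ by positivity)))
      have h := (h1.mul h2).mul_const (-(1 / (2 * ζ)) : ℂ)
      rw [mul_zero, zero_mul] at h
      exact h.congr hFeq)
  have hlim2 := (intervalIntegral_tendsto_integral hGint Filter.tendsto_neg_atTop_atBot Filter.tendsto_id
    ).ofReal |>.const_mul (2 * π * Complex.I)
  have huniq := tendsto_nhds_unique (hlim2.congr fun R => by
    simp only [hFG, id]
    rw [intervalIntegral.integral_const_mul, intervalIntegral.integral_ofReal]) hlim
  have h2πi : (2 * π * Complex.I : ℂ) ≠ 0 := by simp [hπc]
  have hint := mul_left_cancel₀ h2πi huniq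
  rw [Finset.sum_insert (by simp [hlp, hln]), Finset.sum_pair hp0] at hint
  simp only [hrdef, if_true, if_neg hlp.symm, if_neg hln.symm, if_neg hp0.symm] at hint
  have hk := Complex.coth_sub_coth_mul_I lam (ζ / 2) hsin2.ne'
  have hpz : ((ζ / 2 : ℝ) : ℂ) * Complex.I = p := by rw [hp]; push_cast; ring
  rw [hpz, mul_div_cancel₀ ζ two_ne_zero] at hk
  have hfin : ((∫ μ, G μ : ℝ) : ℂ) = ((-(1 / (2 * ζ * Real.cosh (Real.pi * lam / ζ))) +
      Real.sin ζ / (2 * Real.pi * (Real.sinh lam ^ 2 + Real.sin (ζ / 2) ^ 2)) : ℝ) : ℂ) := by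
    have e6 : Real.sin ζ / (2 * π * (Real.sinh lam ^ 2 + Real.sin (ζ / 2) ^ 2)) =
        1 / (2 * π) * (Real.sin ζ / (Real.sinh lam ^ 2 + Real.sin (ζ / 2) ^ 2)) := by
      rw [div_mul_div_comm, one_mul]
    rw [e6, Complex.ofReal_add, Complex.ofReal_mul]
    refine hint.trans ?_
    rw [← sub_eq_add_neg, ← sub_div, hk]
    generalize Real.sin ζ / (Real.sinh lam ^ 2 + Real.sin (ζ / 2) ^ 2) = q
    push_cast
    have : Complex.I * q / (2 * π * Complex.I) = 1 / (2 * π) * q := by field_simp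
    rw [this]
  have := Complex.ofReal_injective hfin
  rw [this]
  ring
end

section
/- Let m ≥ 1 be an integer and β ∈ ℂ. For p = (p₁,…,p_m) ∈ [0,π/2]^m let U(β,p) be the m×m complex matrix with entries U_{kn}(β,p) = e^{2i(k−n)p_n} + e^β e^{2i(n−k)p_n} (1 ≤ k,n ≤ m). Then (1/π^m) ∫_{[0,π/2]^m} det_m U(β,p) dp₁⋯dp_m = det_m T(β), where T(β) is the m×m matrix with entries T_{kn}(β) = (e^β+1)/2 if k = n, and T_{kn}(β) = (1−e^β)(1−(−1)^{n−k})/(2iπ(n−k)) if k ≠ n. -/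
open Complex Finset MeasureTheory

/-- The matrix `U(β,{p})` with entries
`U_{kn} = e^{2i(k−n)p_n} + e^β e^{2i(n−k)p_n}`. -/
noncomputable def U (m : ℕ) (β : ℂ) (p : Fin m → ℝ) :
    Matrix (Fin m) (Fin m) ℂ :=
  Matrix.of fun k n : Fin m =>
    Complex.exp (2 * Complex.I * (((k : ℕ) : ℂ) - ((n : ℕ) : ℂ)) * (p n : ℂ)) +
      Complex.exp β *
        Complex.exp (2 * Complex.I * (((n : ℕ) : ℂ) - ((k : ℕ) : ℂ)) * (p n : ℂ))

/-- The matrix `T(β)` with entries `T_{kn} = (e^β+1)/2` on the diagonal and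
`T_{kn} = (1−e^β)(1−(−1)^{n−k})/(2iπ(n−k))` off the diagonal. -/
noncomputable def T (m : ℕ) (β : ℂ) : Matrix (Fin m) (Fin m) ℂ :=
  Matrix.of fun k n : Fin m =>
    if k = n then (Complex.exp β + 1) / 2
    else (1 - Complex.exp β) * (1 - (-1 : ℂ) ^ (((n : ℕ) : ℤ) - ((k : ℕ) : ℤ))) /
      (2 * Complex.I * (Real.pi : ℂ) * ((((n : ℕ) : ℤ) - ((k : ℕ) : ℤ) : ℤ) : ℂ))

/-- The function `p ↦ U_{kn}` of the single variable `p = p_n`. -/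
noncomputable def entryFun (β : ℂ) (k n : ℕ) (x : ℝ) : ℂ :=
  Complex.exp (2 * Complex.I * ((k : ℂ) - (n : ℂ)) * (x : ℂ)) +
    Complex.exp β * Complex.exp (2 * Complex.I * ((n : ℂ) - (k : ℂ)) * (x : ℂ))

lemma continuous_entryFun (β : ℂ) (k n : ℕ) : Continuous (entryFun β k n) := by
  unfold entryFun
  fun_prop

lemma exp_pi_mul_I_mul_int (d : ℤ) : Complex.exp (d * (Real.pi * Complex.I)) = (-1 : ℂ) ^ d := by
  rw [Complex.exp_int_mul, Complex.exp_pi_mul_I]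

/-- The elementary integral `∫₀^{π/2} e^{2idx} dx` for a nonzero integer `d`. -/
lemma integral_exp_two_mul_I_mul_int {d : ℤ} (hd : d ≠ 0) :
    ∫ x in (0 : ℝ)..(Real.pi / 2), Complex.exp (2 * Complex.I * (d : ℂ) * (x : ℂ)) =
      ((-1 : ℂ) ^ d - 1) / (2 * Complex.I * d) := by
  have hc : 2 * Complex.I * (d : ℂ) ≠ 0 := by simp [hd]
  rw [integral_exp_mul_complex hc, ← exp_pi_mul_I_mul_int]
  congr 2
  · congr 1
    push_cast
    ring
  · simp

lemma integral_entryFun (m : ℕ) (β : ℂ) (k n : Fin m) :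
    ∫ x in Set.Icc (0 : ℝ) (Real.pi / 2), entryFun β k n x = Real.pi * T m β k n := by
  rw [integral_Icc_eq_integral_Ioc,
    ← intervalIntegral.integral_of_le (by positivity : (0 : ℝ) ≤ Real.pi / 2)]
  have hpi : (Real.pi : ℂ) ≠ 0 := by exact_mod_cast Real.pi_ne_zero
  by_cases h : k = n
  · subst h
    simp only [entryFun, T, Matrix.of_apply, sub_self, mul_zero, zero_mul, Complex.exp_zero,
      mul_one, if_true, intervalIntegral.integral_const, sub_zero, Complex.real_smul]
    push_cast
    ring
  · have hne : ((n : ℕ) : ℤ) - ((k : ℕ) : ℤ) ≠ 0 := by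
      intro h0
      exact h (Fin.ext (by omega))
    have hpos := integral_exp_two_mul_I_mul_int hne
    have hneg := integral_exp_two_mul_I_mul_int (neg_ne_zero.mpr hne)
    have hpow : (-1 : ℂ) ^ (-(((n : ℕ) : ℤ) - ((k : ℕ) : ℤ))) =
        (-1 : ℂ) ^ (((n : ℕ) : ℤ) - ((k : ℕ) : ℤ)) := by
      rw [zpow_neg, ← inv_zpow, inv_neg_one]
    have hcast : (((n : ℕ) : ℂ) - ((k : ℕ) : ℂ)) ≠ 0 := by exact_mod_cast hne
    rw [hpow] at hneg
    simp only [entryFun, T, Matrix.of_apply, if_neg h]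
    generalize (-1 : ℂ) ^ (((n : ℕ) : ℤ) - ((k : ℕ) : ℤ)) = s at hpos hneg ⊢
    push_cast [neg_sub] at hpos hneg ⊢
    rw [intervalIntegral.integral_add
      (Continuous.intervalIntegrable (by fun_prop) _ _)
      (Continuous.intervalIntegrable (by fun_prop) _ _),
      intervalIntegral.integral_const_mul, hpos, hneg]
    have hcast' : (((k : ℕ) : ℂ) - ((n : ℕ) : ℂ)) = -(((n : ℕ) : ℂ) - ((k : ℕ) : ℂ)) := by ring
    rw [hcast']
    generalize ((n : ℕ) : ℂ) - ((k : ℕ) : ℂ) = d at hcast ⊢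
    field_simp
    ring

/-- The integral over the cube of a determinant whose `n`-th column depends only on the `n`-th
variable is the determinant of the integrals of the entries. -/
lemma setIntegral_pi_det {ι : Type*} [Fintype ι] [DecidableEq ι] (s : ι → Set ℝ)
    (f : ι → ι → ℝ → ℂ) (hf : ∀ k n, IntegrableOn (f k n) (s n)) :
    ∫ p : ι → ℝ in Set.univ.pi s, Matrix.det (Matrix.of fun k n => f k n (p n)) =
      Matrix.det (Matrix.of fun k n => ∫ x in s n, f k n x) := by
  simp only [Matrix.det_apply', Matrix.of_apply]
  rw [volume_pi, Measure.restrict_pi_pi, integral_finsetSum]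
  · refine Finset.sum_congr rfl fun σ _ => ?_
    rw [integral_const_mul,
      integral_fintype_prod_eq_prod (μ := fun n => volume.restrict (s n))
        (fun n => f (σ n) n)]
  · intro σ _
    exact (Integrable.fintype_prod (μ := fun n => volume.restrict (s n))
      fun n => hf (σ n) n).const_mul _

/-- Free-fermion determinant representation of the generating function:
`(1/π^m) ∫_{[0,π/2]^m} det U(β,p) dp = det T(β)`. -/
theorem integral_det_U_eq_det_T (m : ℕ) (hm : 1 ≤ m) (β : ℂ) :
    (1 / (Real.pi : ℂ) ^ m) *
      ∫ p : Fin m → ℝ in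
        Set.univ.pi (fun _ : Fin m => Set.Icc (0 : ℝ) (Real.pi / 2)),
        Matrix.det (U m β p) = Matrix.det (T m β) := by
  have hpi : (Real.pi : ℂ) ≠ 0 := by exact_mod_cast Real.pi_ne_zero
  have key := setIntegral_pi_det (fun _ : Fin m => Set.Icc (0 : ℝ) (Real.pi / 2))
    (fun k n => entryFun β k n)
    fun k n => (continuous_entryFun β k n).continuousOn.integrableOn_Icc
  have hT : (Matrix.of fun k n : Fin m =>
      ∫ x in Set.Icc (0 : ℝ) (Real.pi / 2), entryFun β k n x) = (Real.pi : ℂ) • T m β := by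
    ext k n
    simp [integral_entryFun]
  rw [hT, Matrix.det_smul, Fintype.card_fin] at key
  change 1 / (Real.pi : ℂ) ^ m * ∫ p : Fin m → ℝ in
      Set.univ.pi (fun _ : Fin m => Set.Icc (0 : ℝ) (Real.pi / 2)),
      Matrix.det (Matrix.of fun k n : Fin m => entryFun β k n (p n)) = _
  rw [key]
  field_simp
end
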